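/- arXiv:2412.09430 — 2 statements merged into one kernel-verified Lean document; each statement's English description precedes it below -/
import Mathlib

section
/- Let Ω be a finite nonempty set and L a negative definite kernel on Ω. Let p¹, …, pⁿ be probability vectors on Ω with nonnegative weights ω_1, …, ω_n summing to one, and let p^ω = Σ_{i=1}^n ω_i pⁱ be the linear pool. Then the average divergence (disagreement) D = Σ_{i=1}^n ω_i d_{S_L}(p^ω, pⁱ) satisfies D = (1/2) Σ_{x∈Ω} Σ_{x̃∈Ω} p^ω(x) p^ω(x̃) L(x, x̃) − (1/2) Σ_{i=1}^n ω_i Σ_{x∈Ω} Σ_{x̃∈Ω} pⁱ(x) pⁱ(x̃) L(x, x̃). -/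
open Finset

/-- The kernel score of a probability vector `p` at outcome `y`, for a kernel `L`
on a finite set `Ω`. -/
noncomputable def kernelScore {Ω : Type*} [Fintype Ω] (L : Ω → Ω → ℝ)
    (p : Ω → ℝ) (y : Ω) : ℝ :=
  (∑ x, p x * L x y) - (1 / 2) * ∑ x, ∑ x', p x * p x' * L x x'

/-- The score divergence `d_{S_L}(h, p)` between probability vectors `h` and `p`. -/
noncomputable def scoreDivergence {Ω : Type*} [Fintype Ω] (L : Ω → Ω → ℝ)
    (h p : Ω → ℝ) : ℝ :=
  (∑ y, p y * kernelScore L h y) - ∑ y, p y * kernelScore L p y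

/-- The expected kernel score of `h` under a probability vector `q`. -/
lemma sum_mul_kernelScore {Ω : Type*} [Fintype Ω] (L : Ω → Ω → ℝ) (h : Ω → ℝ)
    {q : Ω → ℝ} (hq : ∑ y, q y = 1) :
    ∑ y, q y * kernelScore L h y
      = (∑ x, ∑ y, h x * q y * L x y) - (1 / 2) * ∑ x, ∑ x', h x * h x' * L x x' := by
  simp only [kernelScore, mul_sub, Finset.sum_sub_distrib]
  rw [← Finset.sum_mul, hq, one_mul]
  congr 1
  simp only [Finset.mul_sum]
  rw [Finset.sum_comm]
  exact Finset.sum_congr rfl fun x _ => Finset.sum_congr rfl fun y _ => by ring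

/-- For a negative definite kernel `L`, the average divergence
(disagreement) of a linear pool equals half the pool's expected kernel minus the
weighted average of half the components' expected kernels. -/
theorem linear_pool_disagreement_formula
    {Ω : Type*} [Fintype Ω] [Nonempty Ω] {n : ℕ}
    (L : Ω → Ω → ℝ)
    (hL_nonneg : ∀ x x', 0 ≤ L x x')
    (hL_symm : ∀ x x', L x x' = L x' x)
    (hL_diag : ∀ x, L x x = 0)
    (hL_negdef : ∀ c : Ω → ℝ, (∑ x, c x) = 0 →
      (∑ x, ∑ x', c x * c x' * L x x') ≤ 0)
    (p : Fin n → Ω → ℝ)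
    (hp_nonneg : ∀ i x, 0 ≤ p i x) (hp_sum : ∀ i, (∑ x, p i x) = 1)
    (ω : Fin n → ℝ) (hω_nonneg : ∀ i, 0 ≤ ω i) (hω_sum : (∑ i, ω i) = 1)
    (pω : Ω → ℝ) (hpω : pω = fun x => ∑ i, ω i * p i x) :
    (∑ i, ω i * scoreDivergence L pω (p i))
      = (1 / 2) * (∑ x, ∑ x', pω x * pω x' * L x x')
        - (1 / 2) * ∑ i, ω i * ∑ x, ∑ x', p i x * p i x' * L x x' := by
  have pool_sum : ∑ x, pω x = 1 := by
    rw [hpω, Finset.sum_comm]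
    simp [← Finset.mul_sum, hp_sum, hω_sum]
  have pool_score : ∑ i, ω i * ∑ y, p i y * kernelScore L pω y
      = ∑ y, pω y * kernelScore L pω y := by
    have hy : ∀ y, pω y = ∑ i, ω i * p i y := fun y => congrFun hpω y
    generalize kernelScore L pω = s
    simp only [hy, Finset.mul_sum, Finset.sum_mul, mul_assoc]
    exact Finset.sum_comm
  have self_score : ∀ {q : Ω → ℝ}, ∑ y, q y = 1 →
      ∑ y, q y * kernelScore L q y = (1 / 2) * ∑ x, ∑ x', q x * q x' * L x x' := by
    intro q hq
    rw [sum_mul_kernelScore L q hq]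
    ring
  simp only [scoreDivergence, mul_sub, Finset.sum_sub_distrib]
  rw [pool_score, self_score pool_sum]
  congr 1
  rw [Finset.mul_sum]
  exact Finset.sum_congr rfl fun i _ => by rw [self_score (hp_sum i)]; ring
end

section
/- Let Ω be a finite nonempty set and L a negative definite kernel on Ω. Let p¹, …, pⁿ be probability vectors on Ω with nonnegative weights ω_1, …, ω_n summing to one, and let p^ω = Σ_{i=1}^n ω_i pⁱ be the linear pool. Then the linear pool minimizes the average divergence to its components: for every probability vector h on Ω, D_gen(h) ≥ D_gen(p^ω). -/
open Finset

/-- The generalized disagreement of a probability vector `h` around components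
`p i` with weights `ω i`, for a kernel `L` on a finite set `Ω`. -/
noncomputable def genDisagreement {Ω : Type*} [Fintype Ω] {n : ℕ}
    (L : Ω → Ω → ℝ) (ω : Fin n → ℝ) (p : Fin n → Ω → ℝ) (h : Ω → ℝ) : ℝ :=
  ∑ i, ω i * ((∑ x, ∑ x', p i x * h x' * L x x')
      - (1 / 2) * (∑ x, ∑ x', h x * h x' * L x x')
      - (1 / 2) * (∑ x, ∑ x', p i x * p i x' * L x x'))

/-- The disagreement depends on `h` only through its cross term with the linear pool and its own
quadratic term. -/
lemma genDisagreement_eq {Ω : Type*} [Fintype Ω] {n : ℕ}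
    (L : Ω → Ω → ℝ) (ω : Fin n → ℝ) (p : Fin n → Ω → ℝ) (hω_sum : ∑ i, ω i = 1) (h : Ω → ℝ) :
    genDisagreement L ω p h =
      (∑ x, ∑ x', (∑ i, ω i * p i x) * h x' * L x x')
        - (1 / 2) * (∑ x, ∑ x', h x * h x' * L x x')
        - ∑ i, ω i * ((1 / 2) * (∑ x, ∑ x', p i x * p i x' * L x x')) := by
  have cross : ∑ i, ω i * (∑ x, ∑ x', p i x * h x' * L x x') =
      ∑ x, ∑ x', (∑ i, ω i * p i x) * h x' * L x x' := by
    simp only [mul_sum, sum_mul]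
    rw [sum_comm]
    refine sum_congr rfl fun x _ => ?_
    rw [sum_comm]
    exact sum_congr rfl fun x' _ => sum_congr rfl fun i _ => by ring
  simp only [genDisagreement, mul_sub, sum_sub_distrib]
  rw [cross, ← sum_mul, hω_sum, one_mul]

/-- Polarization of the quadratic form of a symmetric kernel. -/
lemma sum_sub_mul_sub_mul_kernel {Ω : Type*} [Fintype Ω] (L : Ω → Ω → ℝ)
    (hL_symm : ∀ x x', L x x' = L x' x) (f g : Ω → ℝ) :
    ∑ x, ∑ x', (f x - g x) * (f x' - g x') * L x x' =
      (∑ x, ∑ x', f x * f x' * L x x') - 2 * (∑ x, ∑ x', g x * f x' * L x x')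
        + ∑ x, ∑ x', g x * g x' * L x x' := by
  have swap : ∑ x, ∑ x', f x * g x' * L x x' = ∑ x, ∑ x', g x * f x' * L x x' := by
    rw [sum_comm]
    exact sum_congr rfl fun x _ => sum_congr rfl fun x' _ => by rw [hL_symm x' x]; ring
  rw [two_mul]
  nth_rewrite 1 [← swap]
  simp only [← sum_add_distrib, ← sum_sub_distrib]
  exact sum_congr rfl fun x _ => sum_congr rfl fun x' _ => by ring

/-- For a negative definite kernel `L`, the linear pool minimizes the
generalized disagreement (average divergence to the components) over all
probability vectors `h`. -/
theorem linear_pool_minimizes_genDisagreement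
    {Ω : Type*} [Fintype Ω] [Nonempty Ω] {n : ℕ}
    (L : Ω → Ω → ℝ)
    (hL_nonneg : ∀ x x', 0 ≤ L x x')
    (hL_symm : ∀ x x', L x x' = L x' x)
    (hL_diag : ∀ x, L x x = 0)
    (hL_negdef : ∀ c : Ω → ℝ, (∑ x, c x) = 0 →
      (∑ x, ∑ x', c x * c x' * L x x') ≤ 0)
    (p : Fin n → Ω → ℝ)
    (hp_nonneg : ∀ i x, 0 ≤ p i x) (hp_sum : ∀ i, (∑ x, p i x) = 1)
    (ω : Fin n → ℝ) (hω_nonneg : ∀ i, 0 ≤ ω i) (hω_sum : (∑ i, ω i) = 1)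
    (pω : Ω → ℝ) (hpω : pω = fun x => ∑ i, ω i * p i x) :
    ∀ h : Ω → ℝ, (∀ x, 0 ≤ h x) → (∑ x, h x) = 1 →
      genDisagreement L ω p h ≥ genDisagreement L ω p pω := by
  intro h _ h_sum
  have pool_sum : ∑ x, pω x = 1 := by
    simp only [hpω]
    rw [sum_comm]
    simp only [← mul_sum, hp_sum, mul_one, hω_sum]
  have key := hL_negdef (fun x => h x - pω x) (by rw [sum_sub_distrib, h_sum, pool_sum, sub_self])
  rw [sum_sub_mul_sub_mul_kernel L hL_symm] at key
  have cross (f : Ω → ℝ) : ∑ x, ∑ x', (∑ i, ω i * p i x) * f x' * L x x' =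
      ∑ x, ∑ x', pω x * f x' * L x x' := by rw [hpω]
  rw [genDisagreement_eq L ω p hω_sum, genDisagreement_eq L ω p hω_sum, cross, cross]
  linarith
end
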